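/- arXiv:1511.02295 — 2 statements merged into one kernel-verified Lean document; each statement's English description precedes it below -/
import Mathlib

section
/- Let each f_n be the moment generating function of a compactly supported probability measure on ℝ, and let f : ℝ → [0,∞] be lower semicontinuous and convex with f(0) < ∞. If f_n converges to f in the Attouch-Wets sense, then at least one of the following holds: (1) f = f_ν for some probability measure ν on ℝ; (2) f(0) < 1; (3) f(0) = 1 and f mimics the moment generating function of some probability measure on ℝ. -/
open MeasureTheory Filter Metric Set
open scoped ENNReal Classical

noncomputable section

/-- Epigraph of an extended-real-valued function on `ℝ`, as a subset of `ℝ²`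
(which carries the box metric `dist p q = max |p₁-q₁| |p₂-q₂|`). -/
def epiE (f : ℝ → EReal) : Set (ℝ × ℝ) := {p | f p.1 ≤ (p.2 : EReal)}

/-- `awGap A B r` is `sup_{x ∈ B̄_r} |dist(x,A) - dist(x,B)|`. -/
def awGap (A B : Set (ℝ × ℝ)) (r : ℝ) : ℝ :=
  sSup ((fun x => |infDist x A - infDist x B|) '' closedBall (0 : ℝ × ℝ) r)

/-- Attouch–Wets convergence of a sequence of functions, via epigraphs. -/
def AWTendsto (F : ℕ → ℝ → EReal) (f : ℝ → EReal) : Prop :=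
  ∀ r : ℝ, 0 < r → Tendsto (fun n => awGap (epiE (F n)) (epiE f) r) atTop (nhds 0)

/-- The basic Attouch–Wets neighbourhood `V_k(f)`. -/
def Vk (k : ℕ) (f : ℝ → EReal) : Set (ℝ → EReal) :=
  {g | awGap (epiE g) (epiE f) (k : ℝ) < 1 / (k : ℝ)}

/-- Convexity for extended-real-valued functions on `ℝ`. -/
def ERConvex (f : ℝ → EReal) : Prop :=
  ∀ x y a b : ℝ, 0 ≤ a → 0 ≤ b → a + b = 1 →
    f (a * x + b * y) ≤ (a : EReal) * f x + (b : EReal) * f y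

/-- Effective domain of an extended-real-valued function. -/
def effDom (f : ℝ → EReal) : Set ℝ := {θ | f θ < ⊤}

/-- The moment generating function of a measure on `ℝ`, with values in `(0,∞]`. -/
def mgfE (ν : Measure ℝ) : ℝ → EReal :=
  fun θ => ((∫⁻ x, ENNReal.ofReal (Real.exp (θ * x)) ∂ν : ℝ≥0∞) : EReal)

/-- `log` of a probability, with the convention `log 0 = -∞`. -/
def elog (p : ℝ≥0∞) : EReal := if p = 0 then ⊥ else ((Real.log p.toReal : ℝ) : EReal)

/-- The empirical moment generating function estimator
`M_n(θ) = (1/n) ∑_{i<n} exp (θ X_i)`. -/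
def Mn {Ω : Type*} (X : ℕ → Ω → ℝ) (n : ℕ) (ω : Ω) : ℝ → EReal :=
  fun θ => (((n : ℝ)⁻¹ * ∑ i ∈ Finset.range n, Real.exp (θ * X i ω) : ℝ) : EReal)

/-- The rate value `I_M(f) = -inf_{k ≥ 1} limsup_n (1/n) log ℙ(M_n ∈ V_k(f))`. -/
def IM {Ω : Type*} [MeasurableSpace Ω] (P : Measure Ω) (X : ℕ → Ω → ℝ)
    (f : ℝ → EReal) : EReal :=
  - ⨅ k ∈ Set.Ici 1, limsup
      (fun n : ℕ => (((n : ℝ)⁻¹ : ℝ) : EReal) * elog (P {ω | Mn X n ω ∈ Vk k f})) atTop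

/-- `f` is lower semicontinuous, convex and `[0,∞]`-valued. -/
def IsAdm0 (f : ℝ → EReal) : Prop :=
  LowerSemicontinuous f ∧ ERConvex f ∧ ∀ θ, 0 ≤ f θ

/-- `f` is the moment generating function of some probability measure. -/
def IsMGF (f : ℝ → EReal) : Prop :=
  ∃ ν : Measure ℝ, IsProbabilityMeasure ν ∧ f = mgfE ν

/-- `f` mimics the moment generating function of `ν`: it is not the mgf of any
probability measure, but agrees with `mgfE ν` on its effective domain. -/
def Mimics (f : ℝ → EReal) (ν : Measure ℝ) : Prop :=
  ¬ IsMGF f ∧ ∀ θ ∈ effDom f, f θ = mgfE ν θ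

theorem epiE_nonempty {f : ℝ → EReal} {θ : ℝ} (h : f θ < ⊤) : (epiE f).Nonempty := by
  obtain ⟨y, hy, -⟩ := EReal.exists_rat_btwn_of_lt h
  exact ⟨(θ, (y : ℝ)), hy.le⟩

theorem isClosed_epiE {f : ℝ → EReal} (hf : LowerSemicontinuous f) : IsClosed (epiE f) :=
  hf.isClosed_epigraph.preimage
    (f := fun p : ℝ × ℝ => (p.1, (p.2 : EReal)))
    (continuous_fst.prodMk (continuous_coe_real_ereal.comp continuous_snd))

theorem abs_infDist_sub_le_awGap (A B : Set (ℝ × ℝ)) {r : ℝ} {x : ℝ × ℝ}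
    (hx : x ∈ closedBall (0 : ℝ × ℝ) r) : |infDist x A - infDist x B| ≤ awGap A B r :=
  le_csSup ((isCompact_closedBall _ _).bddAbove_image
    (((continuous_infDist_pt A).sub (continuous_infDist_pt B)).abs.continuousOn))
    ⟨x, hx, rfl⟩

theorem AWTendsto.tendsto_infDist {F : ℕ → ℝ → EReal} {f : ℝ → EReal} (h : AWTendsto F f)
    (p : ℝ × ℝ) :
    Tendsto (fun n => infDist p (epiE (F n))) atTop (nhds (infDist p (epiE f))) := by
  rw [tendsto_iff_dist_tendsto_zero]
  refine squeeze_zero (fun _ => dist_nonneg) (fun n => ?_) (h (‖p‖ + 1) (by positivity))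
  exact abs_infDist_sub_le_awGap _ _ (by simp)

theorem AWTendsto.eventually_exists_mem {F : ℕ → ℝ → EReal} {f : ℝ → EReal}
    (h : AWTendsto F f) (hF : ∀ n, (epiE (F n)).Nonempty) {p : ℝ × ℝ} (hp : p ∈ epiE f)
    {U : Set (ℝ × ℝ)} (hU : U ∈ nhds p) : ∀ᶠ n in atTop, ∃ q ∈ U, q ∈ epiE (F n) := by
  obtain ⟨δ, hδ, hball⟩ := Metric.mem_nhds_iff.1 hU
  have hlim := h.tendsto_infDist p
  rw [infDist_zero_of_mem hp] at hlim
  filter_upwards [hlim.eventually_lt_const hδ] with n hn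
  obtain ⟨q, hq, hpq⟩ := (infDist_lt_iff (hF n)).1 hn
  exact ⟨q, hball (by rwa [mem_ball, dist_comm]), hq⟩

theorem AWTendsto.eventually_lt {F : ℕ → ℝ → EReal} {f : ℝ → EReal} (h : AWTendsto F f)
    (hf : LowerSemicontinuous f) (hne : (epiE f).Nonempty) {θ y : ℝ} (hy : (y : EReal) < f θ) :
    ∀ᶠ n in atTop, (y : EReal) < F n θ := by
  have hpos : 0 < infDist (θ, y) (epiE f) :=
    ((isClosed_epiE hf).notMem_iff_infDist_pos hne).1 (not_le.2 hy)
  filter_upwards [(h.tendsto_infDist (θ, y)).eventually_const_lt hpos] with n hn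
  by_contra hle
  exact hn.ne' (infDist_zero_of_mem (not_lt.1 hle))

/-- Pointwise, `exp (κ u)` lies below the chord of `exp` through `0` and `u`. -/
theorem exp_mul_le_chord {κ : ℝ} (h0 : 0 ≤ κ) (h1 : κ ≤ 1) (u : ℝ) :
    Real.exp (κ * u) ≤ 1 - κ + κ * Real.exp u := by
  simpa using convexOn_exp.2 (mem_univ 0) (mem_univ u) (sub_nonneg.2 h1) h0 (by ring)

theorem exp_mul_le_truncation_add {a b : ℝ} (ha0 : 0 < a) (ha1 : a ≤ 1) (hab : a ≤ b) {M : ℝ}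
    (hM : 0 ≤ M) (u : ℝ) :
    Real.exp (a * u) ≤ Real.exp (min (a * u) M) + Real.exp (-((b - a) * M)) * Real.exp (b * u) := by
  rcases le_total (a * u) M with h | h
  · rw [min_eq_left h]
    have := Real.exp_pos (-((b - a) * M))
    have := Real.exp_pos (b * u)
    nlinarith
  · rw [← Real.exp_add]
    have hu : 0 ≤ u := nonneg_of_mul_nonneg_right (hM.trans h) ha0
    have hMu : M ≤ u := h.trans (mul_le_of_le_one_left hu ha1)
    have : a * u ≤ -((b - a) * M) + b * u := by nlinarith
    have := Real.exp_le_exp.2 this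
    have := Real.exp_pos (min (a * u) M)
    linarith

theorem exp_mul_add_indicator_le {a M : ℝ} (ha0 : 0 ≤ a) (ha1 : a ≤ 1) (u : ℝ) :
    Real.exp (a * u) + {v : ℝ | M < |v|}.indicator 1 u ≤
      1 + Real.exp (-(a * M)) + (a + Real.exp (-M)) * Real.exp u := by
  have hchord := exp_mul_le_chord ha0 ha1 u
  have h1 := Real.exp_pos (-(a * M))
  have h2 := mul_pos (Real.exp_pos (-M)) (Real.exp_pos u)
  have h3 := mul_nonneg ha0 (Real.exp_pos u).le
  by_cases hu : M < |u|
  · rw [indicator_of_mem (by exact hu), Pi.one_apply]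
    rcases lt_abs.1 hu with h | h
    · have : 1 ≤ Real.exp (-M) * Real.exp u := by
        rw [← Real.exp_add]; exact Real.one_le_exp (by linarith)
      linarith
    · have : Real.exp (a * u) ≤ Real.exp (-(a * M)) := Real.exp_le_exp.2 (by nlinarith)
      linarith
  · rw [indicator_of_notMem (by exact hu)]
    linarith

/-- The bounded continuous function `x ↦ exp (min (t x) M)`. -/
def truncExp (t M : ℝ) : BoundedContinuousFunction ℝ ℝ :=
  BoundedContinuousFunction.ofNormedAddCommGroup (fun x => Real.exp (min (t * x) M))
    (by fun_prop) (Real.exp M) fun x => by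
      rw [Real.norm_eq_abs, Real.abs_exp]
      exact Real.exp_le_exp.2 (min_le_right _ _)

theorem truncExp_apply (t M x : ℝ) : truncExp t M x = Real.exp (min (t * x) M) := rfl

theorem truncExp_le (t M x : ℝ) : truncExp t M x ≤ Real.exp (t * x) :=
  Real.exp_le_exp.2 (min_le_left _ _)

theorem mgfE_eq_coe_integral {ν : Measure ℝ} {t : ℝ}
    (h : Integrable (fun x => Real.exp (t * x)) ν) :
    mgfE ν t = ((∫ x, Real.exp (t * x) ∂ν : ℝ) : EReal) := by
  have h0 : 0 ≤ ∫ x, Real.exp (t * x) ∂ν := integral_nonneg fun _ => (Real.exp_pos _).le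
  rw [mgfE, ← ofReal_integral_eq_lintegral_ofReal h (ae_of_all _ fun _ => (Real.exp_pos _).le),
    EReal.coe_ennreal_ofReal, max_eq_left h0]

theorem mgfE_zero (ν : Measure ℝ) [IsProbabilityMeasure ν] : mgfE ν 0 = 1 := by
  simp [mgfE]

theorem integrable_exp_mul_of_isCompact {ν : Measure ℝ} [IsFiniteMeasure ν] {K : Set ℝ}
    (hK : IsCompact K) (hν : ν Kᶜ = 0) (t : ℝ) : Integrable (fun x => Real.exp (t * x)) ν := by
  have hc : Continuous fun x : ℝ => Real.exp (t * x) := by fun_prop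
  obtain ⟨C, hC⟩ := hK.exists_bound_of_continuousOn hc.continuousOn
  exact .of_bound hc.aestronglyMeasurable C ((measure_eq_zero_iff_ae_notMem.1 hν).mono
    fun x hx => hC x (not_notMem.1 hx))

theorem integrable_exp_mul_smul {ν : Measure ℝ} [IsFiniteMeasure ν] {t κ : ℝ}
    (h : Integrable (fun x => Real.exp (t * x)) ν) (h0 : 0 ≤ κ) (h1 : κ ≤ 1) :
    Integrable (fun x => Real.exp (κ * t * x)) ν := by
  have hc : Continuous fun x : ℝ => Real.exp (κ * t * x) := by fun_prop
  refine ((integrable_const (1 - κ)).add (h.const_mul κ)).mono' hc.aestronglyMeasurable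
    (ae_of_all _ fun x => ?_)
  rw [Real.norm_eq_abs, Real.abs_exp, mul_assoc]
  exact exp_mul_le_chord h0 h1 _

theorem integral_exp_mul_smul_le {ν : Measure ℝ} [IsProbabilityMeasure ν] {t κ : ℝ}
    (h : Integrable (fun x => Real.exp (t * x)) ν) (h0 : 0 ≤ κ) (h1 : κ ≤ 1) :
    ∫ x, Real.exp (κ * t * x) ∂ν ≤ 1 - κ + κ * ∫ x, Real.exp (t * x) ∂ν := by
  calc ∫ x, Real.exp (κ * t * x) ∂ν
      ≤ ∫ x, ((1 - κ) + κ * Real.exp (t * x)) ∂ν :=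
        integral_mono (integrable_exp_mul_smul h h0 h1)
          ((integrable_const (1 - κ)).add (h.const_mul κ)) fun x => by
            simpa [mul_assoc] using exp_mul_le_chord h0 h1 (t * x)
    _ = 1 - κ + κ * ∫ x, Real.exp (t * x) ∂ν := by
        rw [integral_add (integrable_const _) (h.const_mul κ), integral_const_mul]
        simp

/-- Fatou's lemma for the moment generating function, along truncations. -/
theorem mgfE_le_of_forall_truncExp_le {ν : Measure ℝ} [IsProbabilityMeasure ν] {θ y : ℝ}
    (h : ∀ a ∈ Ioo (0 : ℝ) 1, ∀ M, ∫ x, truncExp (a * θ) M x ∂ν ≤ 1 - a + a * y) :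
    mgfE ν θ ≤ y := by
  obtain ⟨a, -, ha, hlim⟩ := exists_seq_strictMono_tendsto' (zero_lt_one (α := ℝ))
  have hbound (k : ℕ) :
      ∫⁻ x, ENNReal.ofReal (truncExp (a k * θ) k x) ∂ν ≤ ENNReal.ofReal (1 - a k + a k * y) := by
    rw [← ofReal_integral_eq_lintegral_ofReal ((truncExp _ _).integrable ν)
      (ae_of_all _ fun _ => (Real.exp_pos _).le)]
    exact ENNReal.ofReal_le_ofReal (h _ (ha k) _)
  have hy0 : 0 ≤ y := by
    have hc : Tendsto (fun k => 1 - a k + a k * y) atTop (nhds (1 - 1 + 1 * y)) :=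
      (tendsto_const_nhds.sub hlim).add (hlim.mul_const y)
    simp only [sub_self, one_mul, zero_add] at hc
    exact ge_of_tendsto' hc fun k =>
      (integral_nonneg fun _ => (Real.exp_pos _).le).trans (h _ (ha k) 0)
  have hc : Tendsto (fun k => ENNReal.ofReal (1 - a k + a k * y)) atTop
      (nhds (ENNReal.ofReal y)) := by
    refine ENNReal.tendsto_ofReal ?_
    simpa using (tendsto_const_nhds (x := (1 : ℝ)).sub hlim).add (hlim.mul_const y)
  have hpt (x : ℝ) : Tendsto (fun k => ENNReal.ofReal (truncExp (a k * θ) k x)) atTop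
      (nhds (ENNReal.ofReal (Real.exp (θ * x)))) := by
    refine ENNReal.tendsto_ofReal ?_
    have hlin : Tendsto (fun k => a k * θ * x) atTop (nhds (θ * x)) := by
      simpa using (hlim.mul_const θ).mul_const x
    refine ((Real.continuous_exp.tendsto _).comp hlin).congr' ?_
    filter_upwards [hlin.eventually_lt_const (lt_add_one _),
      tendsto_natCast_atTop_atTop.eventually_ge_atTop (θ * x + 1)] with k h1 h2
    rw [truncExp_apply, min_eq_left (h1.le.trans h2), Function.comp_apply]
  have hfatou : ∫⁻ x, ENNReal.ofReal (Real.exp (θ * x)) ∂ν ≤ ENNReal.ofReal y :=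
    calc ∫⁻ x, ENNReal.ofReal (Real.exp (θ * x)) ∂ν
        = ∫⁻ x, liminf (fun k => ENNReal.ofReal (truncExp (a k * θ) k x)) atTop ∂ν :=
          lintegral_congr fun x => (hpt x).liminf_eq.symm
      _ ≤ liminf (fun k => ∫⁻ x, ENNReal.ofReal (truncExp (a k * θ) k x) ∂ν) atTop :=
          lintegral_liminf_le fun k =>
            (truncExp (a k * θ) k).continuous.measurable.ennreal_ofReal
      _ ≤ liminf (fun k => ENNReal.ofReal (1 - a k + a k * y)) atTop :=
          liminf_le_liminf (Eventually.of_forall hbound)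
      _ = ENNReal.ofReal y := hc.liminf_eq
  calc mgfE ν θ ≤ ((ENNReal.ofReal y : ℝ≥0∞) : EReal) := EReal.coe_ennreal_le_coe_ennreal_iff.2 hfatou
    _ = y := by rw [EReal.coe_ennreal_ofReal, max_eq_left hy0]

theorem integrable_exp_of_mgfE_lt_top {ν : Measure ℝ} {t : ℝ} (h : mgfE ν t < ⊤) :
    Integrable (fun x => Real.exp (t * x)) ν := by
  have hc : Continuous fun x : ℝ => Real.exp (t * x) := by fun_prop
  refine ⟨hc.aestronglyMeasurable, ?_⟩
  rw [hasFiniteIntegral_iff_ofReal (ae_of_all _ fun _ => (Real.exp_pos _).le)]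
  rw [lt_top_iff_ne_top]
  intro htop
  exact h.ne (by rw [mgfE, htop, EReal.coe_ennreal_top])

section Limits

variable {ν : ℕ → ProbabilityMeasure ℝ} {f : ℝ → EReal}

/-- If `f θ ≤ y`, the mgfs at `a θ`, `0 < a < 1`, are asymptotically below the chord
from `(0, 1)` to `(θ, y)`. -/
theorem eventually_integral_exp_lt
    (hint : ∀ n t, Integrable (fun x => Real.exp (t * x)) (ν n : Measure ℝ))
    (haw : AWTendsto (fun n => mgfE (ν n)) f) {θ y : ℝ} (hθ : θ ≠ 0) (hy : f θ ≤ y)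
    {a : ℝ} (ha : a ∈ Ioo (0 : ℝ) 1) {ε : ℝ} (hε : 0 < ε) :
    ∀ᶠ n in atTop, ∫ x, Real.exp (a * θ * x) ∂(ν n : Measure ℝ) < 1 - a + a * y + ε := by
  have hne (n : ℕ) : (epiE (mgfE (ν n))).Nonempty :=
    epiE_nonempty (θ := 0) (by rw [mgfE_zero]; exact EReal.coe_lt_top 1)
  have hκ : Tendsto (fun p : ℝ × ℝ => a * θ / p.1) (nhds (θ, y)) (nhds a) := by
    have : ContinuousAt (fun p : ℝ × ℝ => a * θ / p.1) (θ, y) :=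
      continuousAt_const.div continuousAt_fst hθ
    simpa [ContinuousAt, hθ] using this
  have hz : Tendsto (fun p : ℝ × ℝ => p.2) (nhds (θ, y)) (nhds y) := continuousAt_snd
  have hchord : Tendsto (fun p : ℝ × ℝ => 1 - a * θ / p.1 + a * θ / p.1 * p.2) (nhds (θ, y))
      (nhds (1 - a + a * y)) := (tendsto_const_nhds.sub hκ).add (hκ.mul hz)
  have hU : ∀ᶠ p : ℝ × ℝ in nhds (θ, y), p.1 ≠ 0 ∧ 0 < a * θ / p.1 ∧ a * θ / p.1 < 1 ∧
      1 - a * θ / p.1 + a * θ / p.1 * p.2 < 1 - a + a * y + ε :=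
    (continuousAt_fst.eventually_ne hθ).and <| (hκ.eventually_const_lt ha.1).and <|
      (hκ.eventually_lt_const ha.2).and (hchord.eventually_lt_const (by linarith))
  filter_upwards [haw.eventually_exists_mem hne (p := (θ, y)) hy hU] with n hn
  obtain ⟨⟨t, z⟩, ⟨ht0, h0, h1, hlt⟩, hmem⟩ := hn
  replace hmem : mgfE (ν n) t ≤ (z : EReal) := hmem
  rw [mgfE_eq_coe_integral (hint n t), EReal.coe_le_coe_iff] at hmem
  have hle := integral_exp_mul_smul_le (hint n t) h0.le h1.le
  dsimp only at ht0 hle hlt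
  rw [div_mul_cancel₀ _ ht0] at hle
  nlinarith [mul_le_mul_of_nonneg_left hmem h0.le]

theorem AWTendsto.eventually_lt_integral_exp
    (hint : ∀ n t, Integrable (fun x => Real.exp (t * x)) (ν n : Measure ℝ))
    (haw : AWTendsto (fun n => mgfE (ν n)) f) (hlsc : LowerSemicontinuous f) (hfin : f 0 < ⊤)
    {θ y : ℝ} (hy : (y : EReal) < f θ) :
    ∀ᶠ n in atTop, y < ∫ x, Real.exp (θ * x) ∂(ν n : Measure ℝ) := by
  filter_upwards [haw.eventually_lt hlsc (epiE_nonempty hfin) hy] with n hn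
  rwa [mgfE_eq_coe_integral (hint n θ), EReal.coe_lt_coe_iff] at hn

theorem integral_exp_add_measureReal_le {μ : Measure ℝ} [IsProbabilityMeasure μ] {s a M : ℝ}
    (h : Integrable (fun x => Real.exp (s * x)) μ) (ha0 : 0 ≤ a) (ha1 : a ≤ 1) :
    ∫ x, Real.exp (a * s * x) ∂μ + μ.real {x | M < |s * x|} ≤
      1 + Real.exp (-(a * M)) + (a + Real.exp (-M)) * ∫ x, Real.exp (s * x) ∂μ := by
  have hmeas : MeasurableSet {x : ℝ | M < |s * x|} :=
    measurableSet_lt measurable_const (by fun_prop)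
  have hind : Integrable ({x : ℝ | M < |s * x|}.indicator (1 : ℝ → ℝ)) μ :=
    (integrable_const (1 : ℝ)).indicator hmeas
  have hexp := integrable_exp_mul_smul h ha0 ha1
  rw [← integral_indicator_one hmeas, ← integral_add hexp hind]
  calc ∫ x, (Real.exp (a * s * x) + {x : ℝ | M < |s * x|}.indicator 1 x) ∂μ
      ≤ ∫ x, (1 + Real.exp (-(a * M)) + (a + Real.exp (-M)) * Real.exp (s * x)) ∂μ := by
        refine integral_mono (hexp.add hind)
          ((integrable_const _).add (h.const_mul _)) fun x => ?_
        simpa [mul_assoc, indicator] using exp_mul_add_indicator_le (M := M) ha0 ha1 (s * x)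
    _ = _ := by
        rw [integral_add (integrable_const _) (h.const_mul _), integral_const_mul]
        simp

theorem AWTendsto.isTightMeasureSet
    (hint : ∀ n t, Integrable (fun x => Real.exp (t * x)) (ν n : Measure ℝ))
    (haw : AWTendsto (fun n => mgfE (ν n)) f) (hlsc : LowerSemicontinuous f) (h0 : f 0 = 1)
    {θ : ℝ} (hθ : θ ≠ 0) (hfθ : f θ < ⊤) (hnn : 0 ≤ f θ) :
    IsTightMeasureSet (range fun n => (ν n : Measure ℝ)) := by
  refine isTightMeasureSet_range_of_tendsto_limsup_measure_norm_gt ?_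
  lift f θ to ℝ using ⟨hfθ.ne, (EReal.bot_lt_zero.trans_le hnn).ne'⟩ with y hy
  have hy0 : 0 ≤ y := by exact_mod_cast hnn
  set s : ℝ := 1 / 2 * θ with hs
  have hs0 : s ≠ 0 := by positivity
  have hC := eventually_integral_exp_lt hint haw hθ hy.symm.le
    (a := 1 / 2) ⟨by norm_num, by norm_num⟩ one_pos
  rw [← hs] at hC
  refine ENNReal.tendsto_nhds_zero.2 fun ε hε => ?_
  obtain ⟨δ, hδ0, hδε⟩ : ∃ δ : ℝ, 0 < δ ∧ ENNReal.ofReal (4 * δ) ≤ ε := by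
    obtain ⟨δ, -, hδ0, hδε⟩ := ENNReal.lt_iff_exists_real_btwn.1 hε
    refine ⟨δ / 4, by linarith [ENNReal.ofReal_pos.1 hδ0], ?_⟩
    rw [mul_div_cancel₀ δ (by norm_num)]
    exact hδε.le
  set C : ℝ := y + 2
  have hlt1 : ((1 - δ : ℝ) : EReal) < f (0 * s) := by
    rw [zero_mul, h0]
    exact_mod_cast sub_lt_self 1 hδ0
  have hcont : ContinuousAt (fun a : ℝ => a * s) 0 := by fun_prop
  have hCcont : ContinuousAt (fun a : ℝ => a * C) 0 := by fun_prop
  obtain ⟨a, ⟨⟨hfa, haC⟩, ha1⟩, ha0⟩ : ∃ a, ((((1 - δ : ℝ) : EReal) < f (a * s) ∧ a * C < δ) ∧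
      a < 1) ∧ a ∈ Ioi (0 : ℝ) :=
    (((((hcont.eventually (hlsc _ _ hlt1)).and
      (hCcont.eventually_lt_const (by simpa using hδ0))).and
      (eventually_lt_nhds one_pos)).filter_mono nhdsWithin_le_nhds).and
      (self_mem_nhdsWithin (s := Ioi (0 : ℝ)))).exists
  have ha0 : 0 < a := ha0
  have hM1 : Tendsto (fun M : ℝ => Real.exp (-(a * M))) atTop (nhds 0) :=
    Real.tendsto_exp_neg_atTop_nhds_zero.comp (tendsto_id.const_mul_atTop ha0)
  have hM2 : Tendsto (fun M : ℝ => Real.exp (-M) * C) atTop (nhds 0) := by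
    simpa using Real.tendsto_exp_neg_atTop_nhds_zero.mul_const C
  obtain ⟨M, hM1, hM2⟩ :=
    ((hM1.eventually_lt_const hδ0).and (hM2.eventually_lt_const hδ0)).exists
  filter_upwards [eventually_ge_atTop (M / |s|)] with r hr
  refine limsup_le_of_le (by isBoundedDefault) ?_
  filter_upwards [hC, haw.eventually_lt_integral_exp hint hlsc
    (by rw [h0]; exact EReal.coe_lt_top 1) hfa] with n hCn hfn
  have htail := integral_exp_add_measureReal_le (M := M) (hint n s) ha0.le ha1.le
  have hCn' : ∫ x, Real.exp (s * x) ∂(ν n : Measure ℝ) ≤ C := by simp only [C]; linarith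
  have hmul := mul_le_mul_of_nonneg_left hCn' (add_pos ha0 (Real.exp_pos (-M))).le
  have hsmall : (ν n : Measure ℝ).real {x | M < |s * x|} ≤ 4 * δ := by linarith
  refine le_trans ?_ hδε
  calc (ν n : Measure ℝ) {x | r < ‖x‖} ≤ (ν n : Measure ℝ) {x | M < |s * x|} := by
        refine measure_mono fun x hx => ?_
        have hx : r < |x| := hx
        have := (div_lt_iff₀ (abs_pos.2 hs0)).1 (hr.trans_lt hx)
        rwa [mem_ofPred_eq, abs_mul, mul_comm]
    _ = ENNReal.ofReal ((ν n : Measure ℝ).real {x | M < |s * x|}) :=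
        (ofReal_measureReal).symm
    _ ≤ ENNReal.ofReal (4 * δ) := ENNReal.ofReal_le_ofReal hsmall

variable {l : Filter ℕ} [l.NeBot] {μ : ProbabilityMeasure ℝ}

theorem mgfE_le_of_tendsto
    (hint : ∀ n t, Integrable (fun x => Real.exp (t * x)) (ν n : Measure ℝ))
    (haw : AWTendsto (fun n => mgfE (ν n)) f) (hl : l ≤ atTop) (hμ : Tendsto ν l (nhds μ))
    {θ y : ℝ} (hθ : θ ≠ 0) (hy : f θ ≤ y) : mgfE μ θ ≤ y := by
  refine mgfE_le_of_forall_truncExp_le fun a ha M => le_of_forall_pos_le_add fun ε hε => ?_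
  have hlim := ProbabilityMeasure.tendsto_iff_forall_integral_tendsto.1 hμ (truncExp (a * θ) M)
  refine le_of_tendsto hlim ?_
  filter_upwards [hl (eventually_integral_exp_lt hint haw hθ hy ha hε)] with n hn
  exact (integral_mono ((truncExp _ _).integrable _) (hint n _)
    fun x => truncExp_le _ _ x).trans hn.le

theorem le_integral_exp_of_tendsto
    (hint : ∀ n t, Integrable (fun x => Real.exp (t * x)) (ν n : Measure ℝ))
    (haw : AWTendsto (fun n => mgfE (ν n)) f) (hlsc : LowerSemicontinuous f) (hfin : f 0 < ⊤)
    (hl : l ≤ atTop) (hμ : Tendsto ν l (nhds μ)) {θ y : ℝ} (hθ : θ ≠ 0) (hy : f θ ≤ y)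
    (hμθ : Integrable (fun x => Real.exp (θ * x)) (μ : Measure ℝ))
    {a z : ℝ} (ha : a ∈ Ioo (0 : ℝ) 1) (hz : (z : EReal) < f (a * θ)) :
    z ≤ ∫ x, Real.exp (a * θ * x) ∂(μ : Measure ℝ) := by
  obtain ⟨b, hab, hb1⟩ := exists_between ha.2
  have hbound (M : ℝ) (hM : 0 ≤ M) : z ≤ ∫ x, Real.exp (a * θ * x) ∂(μ : Measure ℝ) +
      Real.exp (-((b - a) * M)) * (1 - b + b * y + 1) := by
    have hlim := (ProbabilityMeasure.tendsto_iff_forall_integral_tendsto.1 hμ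
      (truncExp (a * θ) M)).add_const (Real.exp (-((b - a) * M)) * (1 - b + b * y + 1))
    refine (ge_of_tendsto hlim ?_).trans (add_le_add_left (integral_mono
      ((truncExp _ _).integrable _) (integrable_exp_mul_smul hμθ ha.1.le ha.2.le)
      fun x => truncExp_le _ _ x) _)
    filter_upwards [hl (haw.eventually_lt_integral_exp hint hlsc hfin hz),
      hl (eventually_integral_exp_lt hint haw hθ hy ⟨ha.1.trans hab, hb1⟩ one_pos)] with n h1 h2
    calc z ≤ ∫ x, Real.exp (a * θ * x) ∂(ν n : Measure ℝ) := h1.le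
      _ ≤ ∫ x, (truncExp (a * θ) M x + Real.exp (-((b - a) * M)) * Real.exp (b * θ * x))
            ∂(ν n : Measure ℝ) := by
          refine integral_mono (hint n _) (((truncExp _ _).integrable _).add
            ((hint n _).const_mul _)) fun x => ?_
          simpa [truncExp_apply, mul_assoc] using
            exp_mul_le_truncation_add ha.1 ha.2.le hab.le hM (θ * x)
      _ = ∫ x, truncExp (a * θ) M x ∂(ν n : Measure ℝ) +
            Real.exp (-((b - a) * M)) * ∫ x, Real.exp (b * θ * x) ∂(ν n : Measure ℝ) := by
          rw [integral_add ((truncExp _ _).integrable _) ((hint n _).const_mul _),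
            integral_const_mul]
      _ ≤ _ := by gcongr
  have hdecay : Tendsto (fun M : ℝ => Real.exp (-((b - a) * M))) atTop (nhds 0) :=
    Real.tendsto_exp_neg_atTop_nhds_zero.comp (tendsto_id.const_mul_atTop (sub_pos.2 hab))
  have hlim := (hdecay.mul_const (1 - b + b * y + 1)).const_add
    (∫ x, Real.exp (a * θ * x) ∂(μ : Measure ℝ))
  rw [zero_mul, add_zero] at hlim
  exact ge_of_tendsto hlim ((eventually_ge_atTop 0).mono hbound)

theorem eq_mgfE_of_tendsto
    (hint : ∀ n t, Integrable (fun x => Real.exp (t * x)) (ν n : Measure ℝ))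
    (haw : AWTendsto (fun n => mgfE (ν n)) f) (hlsc : LowerSemicontinuous f) (h0 : f 0 = 1)
    (hl : l ≤ atTop) (hμ : Tendsto ν l (nhds μ)) {θ : ℝ} (hfθ : f θ < ⊤) (hnn : 0 ≤ f θ) :
    f θ = mgfE μ θ := by
  rcases eq_or_ne θ 0 with rfl | hθ
  · rw [h0, mgfE_zero]
  obtain ⟨y, hy⟩ : ∃ y : ℝ, (y : EReal) = f θ :=
    ⟨_, EReal.coe_toReal hfθ.ne (EReal.bot_lt_zero.trans_le hnn).ne'⟩
  have hle := mgfE_le_of_tendsto hint haw hl hμ hθ hy.ge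
  have hμθ := integrable_exp_of_mgfE_lt_top (hle.trans_lt (EReal.coe_lt_top y))
  refine le_antisymm ?_ (hle.trans hy.le)
  rw [mgfE_eq_coe_integral hμθ]
  refine EReal.ge_of_forall_gt_iff_ge.1 fun z hz => ?_
  rw [EReal.coe_le_coe_iff]
  have hcont : Tendsto (fun a : ℝ => a * θ) (nhdsWithin 1 (Iio 1)) (nhds θ) := by
    have : ContinuousAt (fun a : ℝ => a * θ) 1 := by fun_prop
    simpa [ContinuousAt] using this.tendsto.mono_left nhdsWithin_le_nhds
  have hlim : Tendsto (fun a : ℝ => 1 - a + a * ∫ x, Real.exp (θ * x) ∂(μ : Measure ℝ))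
      (nhdsWithin 1 (Iio 1)) (nhds (∫ x, Real.exp (θ * x) ∂(μ : Measure ℝ))) := by
    have : ContinuousAt (fun a : ℝ => 1 - a + a * ∫ x, Real.exp (θ * x) ∂(μ : Measure ℝ)) 1 := by
      fun_prop
    simpa [ContinuousAt] using this.tendsto.mono_left nhdsWithin_le_nhds
  refine ge_of_tendsto hlim ?_
  filter_upwards [hcont.eventually (hlsc θ z hz), Ioo_mem_nhdsLT (zero_lt_one (α := ℝ))]
    with a hza ha
  exact (le_integral_exp_of_tendsto hint haw hlsc (by rw [h0]; exact EReal.coe_lt_top 1) hl hμ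
    hθ hy.ge hμθ ha hza).trans (integral_exp_mul_smul_le hμθ ha.1.le ha.2.le)

theorem AWTendsto.exists_eq_mgfE
    (hint : ∀ n t, Integrable (fun x => Real.exp (t * x)) (ν n : Measure ℝ))
    (haw : AWTendsto (fun n => mgfE (ν n)) f) (hlsc : LowerSemicontinuous f)
    (hnn : ∀ θ, 0 ≤ f θ) (h0 : f 0 = 1) :
    ∃ μ : ProbabilityMeasure ℝ, ∀ θ ∈ effDom f, f θ = mgfE μ θ := by
  by_cases hdom : ∃ θ ∈ effDom f, θ ≠ 0
  · obtain ⟨θ, hθ, hθ0⟩ := hdom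
    have htight := haw.isTightMeasureSet hint hlsc h0 hθ0 hθ (hnn θ)
    have hcompact : IsCompact (closure (range ν)) :=
      isCompact_closure_of_isTightMeasureSet (by convert htight; simp [range])
    obtain ⟨μ, -, hμ⟩ := hcompact.ultrafilter_le_nhds ((hyperfilter ℕ).map ν)
      (le_principal_iff.2 (mem_map.2 (univ_mem' fun n => subset_closure (mem_range_self n))))
    have hl : (hyperfilter ℕ : Filter ℕ) ≤ atTop := by
      rw [← Nat.cofinite_eq_atTop]; exact hyperfilter_le_cofinite
    exact ⟨μ, fun t ht => eq_mgfE_of_tendsto hint haw hlsc h0 hl hμ ht (hnn t)⟩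
  · push Not at hdom
    let μ : ProbabilityMeasure ℝ := ⟨Measure.dirac 0, inferInstance⟩
    refine ⟨μ, fun θ hθ => ?_⟩
    rw [hdom θ hθ, h0, mgfE_zero]

end Limits

/-- Characterization of Attouch–Wets limits of mgfs of compactly supported
probability measures. -/
theorem limits_of_mgfs
    (F : ℕ → ℝ → EReal) (f : ℝ → EReal)
    (hF : ∀ n, ∃ ν : Measure ℝ, IsProbabilityMeasure ν ∧
      (∃ K : Set ℝ, IsCompact K ∧ ν Kᶜ = 0) ∧ F n = mgfE ν)
    (hlsc : LowerSemicontinuous f) (hconv : ERConvex f)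
    (hnn : ∀ θ, 0 ≤ f θ) (hfin : f 0 < ⊤)
    (haw : AWTendsto F f) :
    (∃ ν : Measure ℝ, IsProbabilityMeasure ν ∧ f = mgfE ν) ∨
    f 0 < 1 ∨
    (f 0 = 1 ∧ ∃ ν : Measure ℝ, IsProbabilityMeasure ν ∧ Mimics f ν) := by
  choose μ hprob hsupp hmgf using hF
  let ν (n : ℕ) : ProbabilityMeasure ℝ := ⟨μ n, hprob n⟩
  have hint (n : ℕ) (t : ℝ) : Integrable (fun x => Real.exp (t * x)) (ν n : Measure ℝ) := by
    obtain ⟨K, hK, hKc⟩ := hsupp n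
    exact integrable_exp_mul_of_isCompact hK hKc t
  obtain rfl : F = fun n => mgfE (ν n) := funext hmgf
  have hle : f 0 ≤ 1 := by
    by_contra! h
    obtain ⟨n, hn⟩ := (haw.eventually_lt hlsc (epiE_nonempty hfin) (y := 1) h).exists
    rw [mgfE_zero] at hn
    exact lt_irrefl _ hn
  rcases hle.lt_or_eq with hlt | h0
  · exact .inr (.inl hlt)
  obtain ⟨ρ, hρ⟩ := haw.exists_eq_mgfE hint hlsc hnn h0
  by_cases hf : IsMGF f
  · exact .inl hf
  · exact .inr (.inr ⟨h0, ρ, inferInstance, hf, hρ⟩)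

end
end

section
/- Let f : ℝ → [0,∞] be lower semicontinuous and convex with f(0) = 1 and D_f ≠ {0}, let k ≥ 1, let ε be admissible at level k, and define f♯_k and A_k(f) accordingly. Then: (i) f ∈ A_k(f); (ii) for every g ∈ A_k(f) there exists m ∈ ℕ with V_m(g) ⊆ A_k(f); (iii) A_k(f) is convex: if g, h ∈ A_k(f) and λ ∈ [0,1] then λg + (1−λ)h ∈ A_k(f); (iv) if ε′ is admissible at level 2k and A_{2k}(f) is defined with ε′, then A_{2k}(f) ⊆ V_k(f). -/
open MeasureTheory Filter Metric Set
open scoped ENNReal Classical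

noncomputable section

def etaSet (f : ℝ → EReal) (k : ℕ) : Set ℝ :=
  {θ | |θ| < 2 * (k : ℝ) + 2 ∧ f θ < ((2 * (k : ℝ) + 2 : ℝ) : EReal)}

def etaL (f : ℝ → EReal) (k : ℕ) : ℝ := sInf (etaSet f k)

def etaR (f : ℝ → EReal) (k : ℕ) : ℝ := sSup (etaSet f k)

/-- `d((a, f a), (b, f b)) < δ` in the box metric on `ℝ × (−∞,∞]`, where a point
with infinite second coordinate is at infinite distance from every point. -/
def closePts (f : ℝ → EReal) (a b δ : ℝ) : Prop :=
  |a - b| < δ ∧ f a < f b + (δ : EReal) ∧ f b < f a + (δ : EReal)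

/-- `ε` is admissible for `f` at level `k`. -/
def Adm (f : ℝ → EReal) (k : ℕ) (ε : ℝ) : Prop :=
  0 < ε ∧ ε < (etaR f k - etaL f k) / 2 ∧
  (∀ a ∈ Set.Icc (etaL f k) (etaL f k + ε), ∀ b ∈ Set.Icc (etaL f k) (etaL f k + ε),
    closePts f a b (1 / (2 * (k : ℝ)))) ∧
  (∀ a ∈ Set.Icc (etaR f k - ε) (etaR f k), ∀ b ∈ Set.Icc (etaR f k - ε) (etaR f k),
    closePts f a b (1 / (2 * (k : ℝ))))

/-- The shifted and curtailed function `f♯_k` (built using a given `ε`). -/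
def fsharp (f : ℝ → EReal) (k : ℕ) (ε : ℝ) : ℝ → EReal :=
  fun θ => if θ ∈ Set.Icc (etaL f k + ε) (etaR f k - ε)
    then f θ + ((1 / (2 * (k : ℝ)) : ℝ) : EReal) else ⊤

def eInfD (f : ℝ → EReal) : EReal := sInf ((fun θ : ℝ => (θ : EReal)) '' effDom f)

def eSupD (f : ℝ → EReal) : EReal := sSup ((fun θ : ℝ => (θ : EReal)) '' effDom f)

/-- `g ⋘ h` : `inf D_g < inf D_h`, `sup D_h < sup D_g` and `g < h` on
`[inf D_h, sup D_h]`. -/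
def lll (g h : ℝ → EReal) : Prop :=
  eInfD g < eInfD h ∧ eSupD h < eSupD g ∧
    ∀ θ : ℝ, eInfD h ≤ (θ : EReal) → (θ : EReal) ≤ eSupD h → g θ < h θ

/-- The local convex base element `A_k(f) = V_k(f♯_k) ∩ {g : g ⋘ f♯_k}`, inside
the class of lower semicontinuous convex `[0,∞]`-valued functions. -/
def Ak (f : ℝ → EReal) (k : ℕ) (ε : ℝ) : Set (ℝ → EReal) :=
  {g | IsAdm0 g ∧ g ∈ Vk k (fsharp f k ε) ∧ lll g (fsharp f k ε)}

theorem awGap_lt_iff {A B : Set (ℝ × ℝ)} {r c : ℝ} (hr : 0 ≤ r) :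
    awGap A B r < c ↔ ∀ x ∈ closedBall (0 : ℝ × ℝ) r, |infDist x A - infDist x B| < c := by
  unfold awGap
  refine IsCompact.sSup_lt_iff_of_continuous (isCompact_closedBall _ _)
    ⟨0, mem_closedBall_self hr⟩ ?_ c
  exact (((continuous_infDist_pt A).sub (continuous_infDist_pt B)).abs).continuousOn

theorem mem_Vk_iff {k : ℕ} {f g : ℝ → EReal} :
    g ∈ Vk k f ↔ ∀ x ∈ closedBall (0 : ℝ × ℝ) (k : ℝ),
      |infDist x (epiE g) - infDist x (epiE f)| < 1 / (k : ℝ) :=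
  awGap_lt_iff (Nat.cast_nonneg k)

theorem coe_toReal_of_mem_effDom {f : ℝ → EReal} (hnn : ∀ θ, 0 ≤ f θ) {x : ℝ}
    (hx : x ∈ effDom f) : (((f x).toReal : ℝ) : EReal) = f x :=
  EReal.coe_toReal (ne_of_lt hx) (ne_of_gt (lt_of_lt_of_le EReal.bot_lt_zero (hnn x)))

theorem ERConvex.convexOn_toReal {f : ℝ → EReal} (hf : ERConvex f) (hnn : ∀ θ, 0 ≤ f θ) :
    ConvexOn ℝ (effDom f) (fun θ => (f θ).toReal) := by
  have key : ∀ x ∈ effDom f, ∀ y ∈ effDom f, ∀ a b : ℝ, 0 ≤ a → 0 ≤ b → a + b = 1 →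
      f (a * x + b * y) ≤ ((a * (f x).toReal + b * (f y).toReal : ℝ) : EReal) := by
    intro x hx y hy a b ha hb hab
    have h := hf x y a b ha hb hab
    rw [← coe_toReal_of_mem_effDom hnn hx, ← coe_toReal_of_mem_effDom hnn hy] at h
    exact_mod_cast h
  refine ⟨fun x hx y hy a b ha hb hab => ?_, fun x hx y hy a b ha hb hab => ?_⟩
  · exact (key x hx y hy a b ha hb hab).trans_lt (EReal.coe_lt_top _)
  · have h := key x hx y hy a b ha hb hab
    have hmem : a * x + b * y ∈ effDom f := h.trans_lt (EReal.coe_lt_top _)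
    rw [← coe_toReal_of_mem_effDom hnn hmem] at h
    simpa only [smul_eq_mul] using EReal.coe_le_coe_iff.1 h

theorem ERConvex.Icc_subset_effDom {f : ℝ → EReal} (hf : ERConvex f) (hnn : ∀ θ, 0 ≤ f θ)
    {a b : ℝ} (ha : f a < ⊤) (hb : f b < ⊤) : Icc a b ⊆ effDom f :=
  (hf.convexOn_toReal hnn).1.ordConnected.out ha hb

theorem ERConvex.continuousOn_toReal {f : ℝ → EReal} (hf : ERConvex f) (hnn : ∀ θ, 0 ≤ f θ)
    {a b : ℝ} (ha : f a < ⊤) (hb : f b < ⊤) :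
    ContinuousOn (fun θ => (f θ).toReal) (Ioo a b) := by
  have h := ((hf.convexOn_toReal hnn).subset (hf.Icc_subset_effDom hnn ha hb)
    (convex_Icc a b)).continuousOn_interior
  rwa [interior_Icc] at h

theorem ERConvex.le_max {f : ℝ → EReal} (hf : ERConvex f) (hnn : ∀ θ, 0 ≤ f θ)
    {x y z u v : ℝ} (hx : f x ≤ u) (hy : f y ≤ v) (hz : z ∈ Icc x y) :
    f z ≤ ((max u v : ℝ) : EReal) := by
  have hx' : x ∈ effDom f := hx.trans_lt (EReal.coe_lt_top _)
  have hy' : y ∈ effDom f := hy.trans_lt (EReal.coe_lt_top _)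
  have hz' : z ∈ effDom f := hf.Icc_subset_effDom hnn hx' hy' hz
  have h := (hf.convexOn_toReal hnn).le_max_of_mem_Icc hx' hy' hz
  rw [← coe_toReal_of_mem_effDom hnn hx'] at hx
  rw [← coe_toReal_of_mem_effDom hnn hy'] at hy
  rw [← coe_toReal_of_mem_effDom hnn hz']
  exact EReal.coe_le_coe_iff.2
    (h.trans (max_le_max (EReal.coe_le_coe_iff.1 hx) (EReal.coe_le_coe_iff.1 hy)))

theorem epiE_anti {f g : ℝ → EReal} (h : ∀ θ, g θ ≤ f θ) : epiE f ⊆ epiE g :=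
  fun p hp => (h p.1).trans hp

/-- When the domain of `s` is a compact interval `[L, R]`, the relation `g ⋘ s` says that `g` is
finite somewhere on both sides of `[L, R]` and lies below `s` on `[L, R]`. -/
theorem lll_iff {g s : ℝ → EReal} {L R : ℝ} (hLR : L ≤ R) (hs : effDom s = Icc L R) :
    lll g s ↔ (∃ a < L, g a < ⊤) ∧ (∃ b > R, g b < ⊤) ∧ ∀ θ ∈ Icc L R, g θ < s θ := by
  have hI : eInfD s = (L : EReal) := by
    unfold eInfD
    rw [hs]
    exact IsLeast.csInf_eq ⟨⟨L, ⟨le_rfl, hLR⟩, rfl⟩, by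
      rintro _ ⟨x, hx, rfl⟩; exact EReal.coe_le_coe_iff.2 hx.1⟩
  have hS : eSupD s = (R : EReal) := by
    unfold eSupD
    rw [hs]
    exact IsGreatest.csSup_eq ⟨⟨R, ⟨hLR, le_rfl⟩, rfl⟩, by
      rintro _ ⟨x, hx, rfl⟩; exact EReal.coe_le_coe_iff.2 hx.2⟩
  unfold lll
  rw [hI, hS]
  refine and_congr ?_ (and_congr ?_ ?_)
  · unfold eInfD
    rw [sInf_lt_iff]
    constructor
    · rintro ⟨_, ⟨x, hx, rfl⟩, h⟩
      exact ⟨x, EReal.coe_lt_coe_iff.1 h, hx⟩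
    · rintro ⟨x, h, hx⟩
      exact ⟨_, ⟨x, hx, rfl⟩, EReal.coe_lt_coe_iff.2 h⟩
  · unfold eSupD
    rw [lt_sSup_iff]
    constructor
    · rintro ⟨_, ⟨x, hx, rfl⟩, h⟩
      exact ⟨x, EReal.coe_lt_coe_iff.1 h, hx⟩
    · rintro ⟨x, h, hx⟩
      exact ⟨_, ⟨x, hx, rfl⟩, EReal.coe_lt_coe_iff.2 h⟩
  · simp only [EReal.coe_le_coe_iff, mem_Icc, and_imp]

/-- A function in a small Attouch–Wets neighbourhood of `g` has a nonempty epigraph. -/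
theorem epiE_nonempty_of_mem_Vk {g h : ℝ → EReal} (hg : ∀ θ, 0 ≤ g θ)
    (hgne : (epiE g).Nonempty) {m : ℕ} (hm : 2 ≤ m) (hh : h ∈ Vk m g) : (epiE h).Nonempty := by
  by_contra hne
  rw [not_nonempty_iff_eq_empty] at hne
  have hm' : (2 : ℝ) ≤ m := by exact_mod_cast hm
  have hx : ((0, -(m : ℝ)) : ℝ × ℝ) ∈ closedBall (0 : ℝ × ℝ) (m : ℝ) := by
    rw [mem_closedBall, dist_zero_right, Prod.norm_def]
    simp
  have h1 := mem_Vk_iff.1 hh _ hx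
  rw [hne, infDist_empty, zero_sub, abs_neg, abs_of_nonneg infDist_nonneg] at h1
  have h2 : (m : ℝ) ≤ infDist ((0, -(m : ℝ)) : ℝ × ℝ) (epiE g) := by
    refine (le_infDist hgne).2 fun p hp => ?_
    have hp2 : (0 : ℝ) ≤ p.2 := EReal.coe_le_coe_iff.1 ((hg p.1).trans hp)
    rw [Prod.dist_eq]
    refine le_max_of_le_right ?_
    rw [Real.dist_eq, abs_sub_comm]
    exact le_trans (by simp only; linarith) (le_abs_self _)
  have h3 : (1 : ℝ) / m ≤ 1 := by
    rw [div_le_one (by linarith)]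
    linarith
  linarith

theorem exists_lll_of_mem_Vk {g s : ℝ → EReal} {L R : ℝ} (hg : IsAdm0 g) (hLR : L ≤ R)
    (hs : effDom s = Icc L R) (hsnn : ∀ θ, 0 ≤ s θ)
    (hsc : ContinuousOn (fun θ => (s θ).toReal) (Icc L R)) (hgs : lll g s) :
    ∃ N : ℕ, ∀ m ≥ N, ∀ h ∈ Vk m g, IsAdm0 h → lll h s := by
  obtain ⟨-, hgc, hgnn⟩ := hg
  obtain ⟨⟨a, haL, ha⟩, ⟨b, hbR, hb⟩, hlt⟩ := (lll_iff hLR hs).1 hgs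
  set G : ℝ → ℝ := fun θ => (g θ).toReal with hG
  set S : ℝ → ℝ := fun θ => (s θ).toReal with hS
  have hgdom := hgc.Icc_subset_effDom hgnn ha hb
  obtain ⟨a', haa', ha'L⟩ := exists_between haL
  obtain ⟨b', hRb', hb'b⟩ := exists_between hbR
  have hGc : ContinuousOn G (Icc a' b') :=
    (hgc.continuousOn_toReal hgnn ha hb).mono (Icc_subset_Ioo haa' hb'b)
  have hsub : Icc L R ⊆ Icc a' b' := Icc_subset_Icc ha'L.le hRb'.le
  have hdom : ∀ θ ∈ Icc a' b', ((G θ : ℝ) : EReal) = g θ := fun θ hθ =>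
    coe_toReal_of_mem_effDom hgnn (hgdom (Icc_subset_Icc haa'.le hb'b.le hθ))
  have hSdom : ∀ θ ∈ Icc L R, ((S θ : ℝ) : EReal) = s θ := fun θ hθ =>
    coe_toReal_of_mem_effDom hsnn (hs ▸ hθ)
  obtain ⟨c, hc, hcS⟩ : ∃ c > 0, ∀ θ ∈ Icc L R, G θ + c ≤ S θ := by
    obtain ⟨θ₀, hθ₀, hmin⟩ := (isCompact_Icc (a := L) (b := R)).exists_isMinOn
      ⟨L, le_rfl, hLR⟩ (hsc.sub (hGc.mono hsub))
    refine ⟨S θ₀ - G θ₀, ?_, fun θ hθ => ?_⟩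
    · have := hlt θ₀ hθ₀
      rw [← hSdom θ₀ hθ₀, ← hdom θ₀ (hsub hθ₀), EReal.coe_lt_coe_iff] at this
      linarith
    · have : S θ₀ - G θ₀ ≤ S θ - G θ := hmin hθ
      linarith
  obtain ⟨δ, hδ, hunif⟩ := Metric.uniformContinuousOn_iff.1
    (isCompact_Icc.uniformContinuousOn_of_continuous hGc) (c / 2) (by linarith)
  set t : ℝ := min (δ / 2) (min (L - a') (b' - R)) with ht
  have ht0 : 0 < t := lt_min (by linarith) (lt_min (by linarith) (by linarith))
  have htδ : t < δ := (min_le_left _ _).trans_lt (by linarith)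
  have htL : t ≤ L - a' := (min_le_right _ _).trans (min_le_left _ _)
  have htR : t ≤ b' - R := (min_le_right _ _).trans (min_le_right _ _)
  obtain ⟨M, hM⟩ := isCompact_Icc.exists_bound_of_continuousOn hGc
  obtain ⟨N₁, hN₁⟩ := exists_nat_gt (max M (max |a'| |b'|))
  obtain ⟨N₂, hN₂⟩ := exists_nat_one_div_lt (lt_min ht0 (half_pos hc))
  refine ⟨max 2 (max N₁ (N₂ + 1)), fun m hm h hh hadm => ?_⟩
  obtain ⟨-, hhc, hhnn⟩ := hadm
  have hm2 : 2 ≤ m := (le_max_left _ _).trans hm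
  have hm1 : (N₁ : ℝ) ≤ m := by
    exact_mod_cast (le_max_left _ _).trans ((le_max_right _ _).trans hm)
  have hm3 : (N₂ : ℝ) + 1 ≤ m := by
    exact_mod_cast (le_max_right _ _).trans ((le_max_right _ _).trans hm)
  have hsmall : 1 / (m : ℝ) < min t (c / 2) :=
    (one_div_le_one_div_of_le (by positivity) hm3).trans_lt hN₂
  have hmem : ∀ θ ∈ Icc a' b', ((θ, G θ) : ℝ × ℝ) ∈ epiE g := fun θ hθ => (hdom θ hθ).ge
  have hgne : (epiE g).Nonempty := ⟨_, hmem L (hsub ⟨le_rfl, hLR⟩)⟩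
  have hhne := epiE_nonempty_of_mem_Vk hgnn hgne hm2 hh
  have near : ∀ θ ∈ Icc a' b', ∃ u v : ℝ, h u ≤ v ∧ |θ - u| < t ∧ v < G θ + c / 2 := by
    intro θ hθ
    have hball : ((θ, G θ) : ℝ × ℝ) ∈ closedBall (0 : ℝ × ℝ) (m : ℝ) := by
      rw [mem_closedBall, dist_zero_right, Prod.norm_def]
      refine max_le ?_ ?_
      · have h1 : |θ| ≤ max |a'| |b'| := abs_le_max_abs_abs hθ.1 hθ.2
        exact h1.trans ((le_max_right _ _).trans (hN₁.le.trans hm1))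
      · exact (hM θ hθ).trans ((le_max_left _ _).trans (hN₁.le.trans hm1))
    have h1 := mem_Vk_iff.1 hh _ hball
    rw [infDist_zero_of_mem (hmem θ hθ), sub_zero, abs_of_nonneg infDist_nonneg] at h1
    obtain ⟨⟨u, v⟩, hp, hd⟩ := (infDist_lt_iff hhne).1 (h1.trans hsmall)
    rw [Prod.dist_eq, max_lt_iff, Real.dist_eq, Real.dist_eq] at hd
    refine ⟨u, v, hp, hd.1.trans_le (min_le_left _ _), ?_⟩
    have := (abs_lt.1 (hd.2.trans_le (min_le_right _ _))).1
    linarith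
  have sides : ∀ θ ∈ Icc L R, ∃ u₁ v₁ u₂ v₂ : ℝ, u₁ < θ ∧ h u₁ ≤ v₁ ∧ v₁ < G θ + c ∧
      θ < u₂ ∧ h u₂ ≤ v₂ ∧ v₂ < G θ + c := by
    intro θ hθ
    have hl : θ - t ∈ Icc a' b' := ⟨by linarith [hθ.1], by linarith [hθ.2]⟩
    have hr : θ + t ∈ Icc a' b' := ⟨by linarith [hθ.1], by linarith [hθ.2]⟩
    obtain ⟨u₁, v₁, h1, h2, h3⟩ := near _ hl
    obtain ⟨u₂, v₂, h4, h5, h6⟩ := near _ hr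
    have hGl := hunif _ hl θ (hsub hθ) (by
      rw [Real.dist_eq, sub_sub_cancel_left, abs_neg, abs_of_pos ht0]; exact htδ)
    have hGr := hunif _ hr θ (hsub hθ) (by
      rw [Real.dist_eq, add_sub_cancel_left, abs_of_pos ht0]; exact htδ)
    rw [Real.dist_eq, abs_lt] at hGl hGr
    rw [abs_lt] at h2 h5
    exact ⟨u₁, v₁, u₂, v₂, by linarith, h1, by linarith, by linarith, h4, by linarith⟩
  refine (lll_iff hLR hs).2 ⟨?_, ?_, fun θ hθ => ?_⟩
  · obtain ⟨u, v, -, -, h1, h2, -⟩ := sides L ⟨le_rfl, hLR⟩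
    exact ⟨u, h1, h2.trans_lt (EReal.coe_lt_top _)⟩
  · obtain ⟨-, -, u, v, -, -, -, h1, h2, -⟩ := sides R ⟨hLR, le_rfl⟩
    exact ⟨u, h1, h2.trans_lt (EReal.coe_lt_top _)⟩
  · obtain ⟨u₁, v₁, u₂, v₂, h1, h2, h3, h4, h5, h6⟩ := sides θ hθ
    refine (hhc.le_max hhnn h2 h5 ⟨h1.le, h4.le⟩).trans_lt ?_
    rw [← hSdom θ hθ, EReal.coe_lt_coe_iff]
    exact (max_lt h3 h6).trans_le (hcS θ hθ)

section Curtailed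

variable {f : ℝ → EReal} {k : ℕ} {ε : ℝ}

theorem etaSet_subset_Icc (f : ℝ → EReal) (k : ℕ) :
    etaSet f k ⊆ Icc (etaL f k) (etaR f k) := by
  have hb : ∀ θ ∈ etaSet f k, -(2 * (k : ℝ) + 2) ≤ θ ∧ θ ≤ 2 * (k : ℝ) + 2 :=
    fun θ hθ => abs_le.1 hθ.1.le
  exact fun θ hθ => ⟨csInf_le ⟨_, fun x hx => (hb x hx).1⟩ hθ,
    le_csSup ⟨_, fun x hx => (hb x hx).2⟩ hθ⟩

theorem Adm.lt_top_etaL (h : Adm f k ε) : f (etaL f k) < ⊤ := by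
  have hmem : etaL f k ∈ Icc (etaL f k) (etaL f k + ε) := ⟨le_rfl, by linarith [h.1]⟩
  exact (h.2.2.1 _ hmem _ hmem).2.1.trans_le le_top

theorem Adm.lt_top_etaR (h : Adm f k ε) : f (etaR f k) < ⊤ := by
  have hmem : etaR f k ∈ Icc (etaR f k - ε) (etaR f k) := ⟨by linarith [h.1], le_rfl⟩
  exact (h.2.2.2 _ hmem _ hmem).2.1.trans_le le_top

theorem Adm.le (h : Adm f k ε) : etaL f k + ε ≤ etaR f k - ε := by
  linarith [h.2.1]

theorem Adm.Icc_subset (h : Adm f k ε) :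
    Icc (etaL f k + ε) (etaR f k - ε) ⊆ Ioo (etaL f k) (etaR f k) :=
  Icc_subset_Ioo (by linarith [h.1]) (by linarith [h.1])

theorem fsharp_of_mem {θ : ℝ} (hθ : θ ∈ Icc (etaL f k + ε) (etaR f k - ε)) :
    fsharp f k ε θ = f θ + ((1 / (2 * (k : ℝ)) : ℝ) : EReal) := if_pos hθ

theorem coe_one_div_nonneg (k : ℕ) : (0 : EReal) ≤ ((1 / (2 * (k : ℝ)) : ℝ) : EReal) :=
  EReal.coe_nonneg.2 (by positivity)

theorem le_fsharp (f : ℝ → EReal) (k : ℕ) (ε : ℝ) (θ : ℝ) : f θ ≤ fsharp f k ε θ := by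
  unfold fsharp
  split_ifs
  · exact le_add_of_nonneg_right (coe_one_div_nonneg k)
  · exact le_top

theorem Adm.lt_top_of_mem (h : Adm f k ε) (hconv : ERConvex f) (hnn : ∀ θ, 0 ≤ f θ) {θ : ℝ}
    (hθ : θ ∈ Icc (etaL f k + ε) (etaR f k - ε)) : f θ < ⊤ :=
  hconv.Icc_subset_effDom hnn h.lt_top_etaL h.lt_top_etaR (Ioo_subset_Icc_self (h.Icc_subset hθ))

theorem Adm.effDom_fsharp (h : Adm f k ε) (hconv : ERConvex f) (hnn : ∀ θ, 0 ≤ f θ) :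
    effDom (fsharp f k ε) = Icc (etaL f k + ε) (etaR f k - ε) := by
  ext θ
  constructor
  · intro hθ
    by_contra hn
    exact (show fsharp f k ε θ < ⊤ from hθ).ne (if_neg hn)
  · intro hθ
    change fsharp f k ε θ < ⊤
    rw [fsharp_of_mem hθ]
    exact EReal.add_lt_top (h.lt_top_of_mem hconv hnn hθ).ne (EReal.coe_ne_top _)

theorem Adm.continuousOn_fsharp (h : Adm f k ε) (hconv : ERConvex f) (hnn : ∀ θ, 0 ≤ f θ) :
    ContinuousOn (fun θ => (fsharp f k ε θ).toReal)
      (Icc (etaL f k + ε) (etaR f k - ε)) := by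
  have hc := (hconv.continuousOn_toReal hnn h.lt_top_etaL h.lt_top_etaR).mono h.Icc_subset
  refine (hc.add (continuousOn_const (c := 1 / (2 * (k : ℝ))))).congr fun θ hθ => ?_
  change (fsharp f k ε θ).toReal = (f θ).toReal + 1 / (2 * (k : ℝ))
  rw [fsharp_of_mem hθ,
    ← coe_toReal_of_mem_effDom hnn (x := θ) (h.lt_top_of_mem hconv hnn hθ), ← EReal.coe_add,
    EReal.toReal_coe, EReal.toReal_coe]

theorem Adm.lll_fsharp (h : Adm f k ε) (hk : 1 ≤ k) (hconv : ERConvex f)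
    (hnn : ∀ θ, 0 ≤ f θ) : lll f (fsharp f k ε) := by
  have hk' : (0 : ℝ) < k := by exact_mod_cast hk
  refine (lll_iff h.le (h.effDom_fsharp hconv hnn)).2
    ⟨⟨_, by linarith [h.1], h.lt_top_etaL⟩, ⟨etaR f k, by linarith [h.1], h.lt_top_etaR⟩,
      fun θ hθ => ?_⟩
  rw [fsharp_of_mem hθ,
    ← coe_toReal_of_mem_effDom hnn (x := θ) (h.lt_top_of_mem hconv hnn hθ), ← EReal.coe_add,
    EReal.coe_lt_coe_iff]
  have : 0 < 1 / (2 * (k : ℝ)) := by positivity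
  linarith

theorem Adm.epiE_fsharp_nonempty (h : Adm f k ε) (hconv : ERConvex f) (hnn : ∀ θ, 0 ≤ f θ) :
    (epiE (fsharp f k ε)).Nonempty := by
  have hL : etaL f k + ε ∈ effDom (fsharp f k ε) := by
    rw [h.effDom_fsharp hconv hnn]
    exact ⟨le_rfl, h.le⟩
  exact ⟨(_, _), (coe_toReal_of_mem_effDom
    (fun θ => (hnn θ).trans (le_fsharp f k ε θ)) hL).ge⟩

/-- Every point of the epigraph of `f` over `[η_l, η_r]` is closer than `1 / k` to the epigraph
of `f♯_k`. -/
theorem Adm.exists_dist_lt (h : Adm f k ε) (hk : 1 ≤ k) {p : ℝ × ℝ} (hp : p ∈ epiE f)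
    (hp1 : p.1 ∈ Icc (etaL f k) (etaR f k)) :
    ∃ q ∈ epiE (fsharp f k ε), dist p q < 1 / (k : ℝ) := by
  have hk' : (0 : ℝ) < k := by exact_mod_cast hk
  have hhalf : 1 / (2 * (k : ℝ)) + 1 / (2 * (k : ℝ)) = 1 / (k : ℝ) := by
    field_simp; norm_num
  have hpos : 0 < 1 / (2 * (k : ℝ)) := by positivity
  have aux : ∀ c ∈ Icc (etaL f k + ε) (etaR f k - ε), closePts f p.1 c (1 / (2 * (k : ℝ))) →
      ∃ q ∈ epiE (fsharp f k ε), dist p q < 1 / (k : ℝ) := by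
    rintro c hc ⟨h1, -, h3⟩
    have h4 : f c < ((p.2 + 1 / (2 * (k : ℝ)) : ℝ) : EReal) := by
      rw [EReal.coe_add]
      exact h3.trans_le (add_le_add_left hp _)
    obtain ⟨v, hv, hv'⟩ := EReal.lt_iff_exists_real_btwn.1 h4
    have hv'' := EReal.coe_lt_coe_iff.1 hv'
    have hmem : fsharp f k ε c ≤ ((max v p.2 + 1 / (2 * (k : ℝ)) : ℝ) : EReal) := by
      rw [fsharp_of_mem hc, EReal.coe_add]
      exact add_le_add_left (hv.le.trans (EReal.coe_le_coe_iff.2 (le_max_left _ _))) _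
    refine ⟨(c, max v p.2 + 1 / (2 * (k : ℝ))), hmem, ?_⟩
    rw [Prod.dist_eq, Real.dist_eq, Real.dist_eq]
    refine max_lt (by simp only; linarith) (abs_lt.2 ⟨?_, ?_⟩)
    · have : max v p.2 < p.2 + 1 / (2 * (k : ℝ)) := max_lt hv'' (by linarith)
      simp only
      linarith
    · have : p.2 ≤ max v p.2 := le_max_right _ _
      simp only
      linarith
  have hε := h.1
  have hle := h.le
  rcases lt_or_ge p.1 (etaL f k + ε) with hl | hl
  · exact aux _ ⟨le_rfl, hle⟩ (h.2.2.1 _ ⟨hp1.1, hl.le⟩ _ ⟨by linarith, le_rfl⟩)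
  rcases lt_or_ge (etaR f k - ε) p.1 with hr | hr
  · exact aux _ ⟨hle, le_rfl⟩ (h.2.2.2 _ ⟨hr.le, hp1.2⟩ _ ⟨le_rfl, by linarith⟩)
  · refine ⟨(p.1, p.2 + 1 / (2 * (k : ℝ))), ?_, ?_⟩
    · change fsharp f k ε p.1 ≤ ((p.2 + 1 / (2 * (k : ℝ)) : ℝ) : EReal)
      rw [fsharp_of_mem ⟨hl, hr⟩, EReal.coe_add]
      exact add_le_add_left hp _
    · rw [Prod.dist_eq, Real.dist_eq, Real.dist_eq]
      refine max_lt (by simp only [sub_self, abs_zero]; linarith) ?_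
      simp only [sub_add_cancel_left, abs_neg]
      rw [abs_of_pos hpos]
      linarith

theorem Adm.mem_Vk (h : Adm f k ε) (hk : 1 ≤ k) (hlsc : LowerSemicontinuous f)
    (hconv : ERConvex f) (hnn : ∀ θ, 0 ≤ f θ) (h0 : f 0 = 1) :
    f ∈ Vk k (fsharp f k ε) := by
  refine mem_Vk_iff.2 fun x hx => ?_
  have hne := h.epiE_fsharp_nonempty hconv hnn
  have hsub := epiE_anti (le_fsharp f k ε)
  have h01 : ((0, 1) : ℝ × ℝ) ∈ epiE f := by
    change f 0 ≤ ((1 : ℝ) : EReal)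
    rw [h0]
    exact le_rfl
  obtain ⟨p, hp, hxp⟩ := (isClosed_epiE hlsc).exists_infDist_eq_dist ⟨_, h01⟩ x
  rw [mem_closedBall, dist_zero_right] at hx
  have hd : dist x p ≤ k + 1 := by
    rw [← hxp]
    refine (infDist_le_dist_of_mem h01).trans ((dist_le_norm_add_norm _ _).trans ?_)
    have : ‖((0, 1) : ℝ × ℝ)‖ = 1 := by simp [Prod.norm_def]
    linarith
  have hpn : ‖p‖ ≤ 2 * (k : ℝ) + 1 := by
    have := norm_le_norm_add_norm_sub x p
    rw [dist_eq_norm] at hd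
    linarith
  rw [Prod.norm_def, max_le_iff, Real.norm_eq_abs, Real.norm_eq_abs] at hpn
  have hpη : p.1 ∈ etaSet f k := by
    refine ⟨by linarith [hpn.1], hp.trans_lt (EReal.coe_lt_coe_iff.2 ?_)⟩
    linarith [le_abs_self p.2, hpn.2]
  obtain ⟨q, hq, hpq⟩ := h.exists_dist_lt hk hp (etaSet_subset_Icc f k hpη)
  have h1 : infDist x (epiE (fsharp f k ε)) ≤ dist x p + dist p q :=
    (infDist_le_dist_of_mem hq).trans (dist_triangle _ _ _)
  have h2 := infDist_le_infDist_of_subset (x := x) hsub hne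
  rw [abs_lt]
  constructor <;> linarith

theorem Adm.mem_Ak (h : Adm f k ε) (hk : 1 ≤ k) (hlsc : LowerSemicontinuous f)
    (hconv : ERConvex f) (hnn : ∀ θ, 0 ≤ f θ) (h0 : f 0 = 1) : f ∈ Ak f k ε :=
  ⟨⟨hlsc, hconv, hnn⟩, h.mem_Vk hk hlsc hconv hnn h0, h.lll_fsharp hk hconv hnn⟩

theorem Adm.exists_Vk_subset_Ak (h : Adm f k ε) (hk : 1 ≤ k) (hconv : ERConvex f)
    (hnn : ∀ θ, 0 ≤ f θ) {g : ℝ → EReal} (hg : g ∈ Ak f k ε) :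
    ∃ m : ℕ, 1 ≤ m ∧ ∀ u ∈ Vk m g, IsAdm0 u → u ∈ Ak f k ε := by
  obtain ⟨hg0, hgV, hgl⟩ := hg
  obtain ⟨N, hN⟩ := exists_lll_of_mem_Vk hg0 h.le (h.effDom_fsharp hconv hnn)
    (fun θ => (hnn θ).trans (le_fsharp f k ε θ)) (h.continuousOn_fsharp hconv hnn) hgl
  have hgap : awGap (epiE g) (epiE (fsharp f k ε)) (k : ℝ) < 1 / (k : ℝ) := hgV
  obtain ⟨c, hc1, hc2⟩ := exists_between hgap
  obtain ⟨n, hn⟩ := exists_nat_one_div_lt (sub_pos.2 hc2)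
  refine ⟨max N (max k (n + 1)), hk.trans ((le_max_left _ _).trans (le_max_right _ _)),
    fun u hu hu0 => ⟨hu0, mem_Vk_iff.2 fun x hx => ?_, hN _ (le_max_left _ _) u hu hu0⟩⟩
  set m := max N (max k (n + 1))
  have hkm : (k : ℝ) ≤ m := by
    exact_mod_cast (le_max_left k (n + 1)).trans (le_max_right _ _)
  have hnm : (n : ℝ) + 1 ≤ m := by
    exact_mod_cast (le_max_right k (n + 1)).trans (le_max_right _ _)
  have h1 := mem_Vk_iff.1 hu x (closedBall_subset_closedBall hkm hx)
  have h2 := (awGap_lt_iff (Nat.cast_nonneg k)).1 hc1 x hx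
  have h3 : 1 / (m : ℝ) ≤ 1 / ((n : ℝ) + 1) := one_div_le_one_div_of_le (by positivity) hnm
  have h4 := abs_sub_le (infDist x (epiE u)) (infDist x (epiE g))
    (infDist x (epiE (fsharp f k ε)))
  linarith

theorem Adm.subset_Vk (h : Adm f (2 * k) ε) (hk : 1 ≤ k) (hlsc : LowerSemicontinuous f)
    (hconv : ERConvex f) (hnn : ∀ θ, 0 ≤ f θ) (h0 : f 0 = 1) : Ak f (2 * k) ε ⊆ Vk k f := by
  intro g hg
  have hk' : (0 : ℝ) < k := by exact_mod_cast hk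
  refine mem_Vk_iff.2 fun x hx => ?_
  have hx' : x ∈ closedBall (0 : ℝ × ℝ) ((2 * k : ℕ) : ℝ) :=
    closedBall_subset_closedBall (by push_cast; linarith) hx
  have h1 := mem_Vk_iff.1 hg.2.1 x hx'
  have h2 := mem_Vk_iff.1 (h.mem_Vk (by omega) hlsc hconv hnn h0) x hx'
  have h3 := abs_sub_le (infDist x (epiE g)) (infDist x (epiE (fsharp f (2 * k) ε)))
    (infDist x (epiE f))
  rw [abs_sub_comm] at h2
  have hhalf : 1 / ((2 * k : ℕ) : ℝ) + 1 / ((2 * k : ℕ) : ℝ) = 1 / (k : ℝ) := by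
    push_cast; field_simp; norm_num
  linarith

end Curtailed

theorem lowerSemicontinuous_coe_mul {g : ℝ → EReal} (hg : LowerSemicontinuous g) {a : ℝ}
    (ha : 0 < a) : LowerSemicontinuous (fun θ => (a : EReal) * g θ) := by
  refine Continuous.comp_lowerSemicontinuous (g := fun y : EReal => (a : EReal) * y) ?_ hg
    fun x y hxy => mul_le_mul_of_nonneg_left hxy (EReal.coe_nonneg.2 ha.le)
  refine continuous_iff_continuousAt.2 fun y => ?_
  have ha' : (a : EReal) ≠ 0 := by exact_mod_cast ha.ne'
  exact (EReal.continuousAt_mul (p := ((a : EReal), y)) (Or.inl ha') (Or.inl ha')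
    (Or.inl (EReal.coe_ne_bot a)) (Or.inl (EReal.coe_ne_top a))).comp
    (continuousAt_const.prodMk continuousAt_id)

theorem IsAdm0.convex_comb {g h : ℝ → EReal} (hg : IsAdm0 g) (hh : IsAdm0 h) {a b : ℝ}
    (ha : 0 < a) (hb : 0 < b) : IsAdm0 (fun θ => (a : EReal) * g θ + (b : EReal) * h θ) := by
  obtain ⟨hg1, hg2, hg3⟩ := hg
  obtain ⟨hh1, hh2, hh3⟩ := hh
  have ha' : (0 : EReal) ≤ a := EReal.coe_nonneg.2 ha.le
  have hb' : (0 : EReal) ≤ b := EReal.coe_nonneg.2 hb.le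
  have hag : ∀ θ, 0 ≤ (a : EReal) * g θ := fun θ => mul_nonneg ha' (hg3 θ)
  have hbh : ∀ θ, 0 ≤ (b : EReal) * h θ := fun θ => mul_nonneg hb' (hh3 θ)
  have nebot : ∀ {x : EReal}, 0 ≤ x → x ≠ ⊥ := fun hx =>
    ne_of_gt (lt_of_lt_of_le EReal.bot_lt_zero hx)
  refine ⟨?_, ?_, fun θ => add_nonneg (hag θ) (hbh θ)⟩
  · exact (lowerSemicontinuous_coe_mul hg1 ha).add' (lowerSemicontinuous_coe_mul hh1 hb)
      fun θ => EReal.continuousAt_add (Or.inr (nebot (hbh θ))) (Or.inl (nebot (hag θ)))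
  · intro x y c d hc hd hcd
    have hc' : (0 : EReal) ≤ c := EReal.coe_nonneg.2 hc
    have hd' : (0 : EReal) ≤ d := EReal.coe_nonneg.2 hd
    have h1 := mul_le_mul_of_nonneg_left (hg2 x y c d hc hd hcd) ha'
    have h2 := mul_le_mul_of_nonneg_left (hh2 x y c d hc hd hcd) hb'
    refine (add_le_add h1 h2).trans_eq ?_
    rw [EReal.left_distrib_of_nonneg (mul_nonneg hc' (hg3 x)) (mul_nonneg hd' (hg3 y)),
      EReal.left_distrib_of_nonneg (mul_nonneg hc' (hh3 x)) (mul_nonneg hd' (hh3 y)),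
      EReal.left_distrib_of_nonneg (hag x) (hbh x), EReal.left_distrib_of_nonneg (hag y) (hbh y),
      mul_left_comm (a : EReal) c, mul_left_comm (a : EReal) d, mul_left_comm (b : EReal) c,
      mul_left_comm (b : EReal) d]
    exact add_add_add_comm _ _ _ _

theorem min_le_coe_mul_add {x y : EReal} {a b : ℝ} (ha : 0 ≤ a)
    (hb : 0 ≤ b) (hab : a + b = 1) : min x y ≤ (a : EReal) * x + (b : EReal) * y := by
  have ha' : (0 : EReal) ≤ a := EReal.coe_nonneg.2 ha
  have hb' : (0 : EReal) ≤ b := EReal.coe_nonneg.2 hb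
  calc min x y = ((a + b : ℝ) : EReal) * min x y := by rw [hab, EReal.coe_one, one_mul]
    _ = (a : EReal) * min x y + (b : EReal) * min x y := by
      rw [EReal.coe_add, EReal.right_distrib_of_nonneg ha' hb']
    _ ≤ _ := add_le_add (mul_le_mul_of_nonneg_left (min_le_left _ _) ha')
      (mul_le_mul_of_nonneg_left (min_le_right _ _) hb')

theorem coe_mul_add_le_max {x y : EReal} {a b : ℝ} (ha : 0 ≤ a)
    (hb : 0 ≤ b) (hab : a + b = 1) : (a : EReal) * x + (b : EReal) * y ≤ max x y := by
  have ha' : (0 : EReal) ≤ a := EReal.coe_nonneg.2 ha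
  have hb' : (0 : EReal) ≤ b := EReal.coe_nonneg.2 hb
  calc _ ≤ (a : EReal) * max x y + (b : EReal) * max x y :=
      add_le_add (mul_le_mul_of_nonneg_left (le_max_left _ _) ha')
        (mul_le_mul_of_nonneg_left (le_max_right _ _) hb')
    _ = ((a + b : ℝ) : EReal) * max x y := by
      rw [EReal.coe_add, EReal.right_distrib_of_nonneg ha' hb']
    _ = max x y := by rw [hab, EReal.coe_one, one_mul]

theorem Adm.Ak_convex_comb {f : ℝ → EReal} {k : ℕ} {ε : ℝ} (hε : Adm f k ε)
    (hconv : ERConvex f) (hnn : ∀ θ, 0 ≤ f θ) {g h : ℝ → EReal} (hg : g ∈ Ak f k ε)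
    (hh : h ∈ Ak f k ε) {a b : ℝ} (ha : 0 < a) (hb : 0 < b) (hab : a + b = 1) :
    (fun θ => (a : EReal) * g θ + (b : EReal) * h θ) ∈ Ak f k ε := by
  obtain ⟨hg0, hgV, hgl⟩ := hg
  obtain ⟨hh0, hhV, hhl⟩ := hh
  have hdom := hε.effDom_fsharp hconv hnn
  have hlll := lll_iff (g := fun θ => (a : EReal) * g θ + (b : EReal) * h θ) hε.le hdom
  rw [lll_iff hε.le hdom] at hgl hhl
  obtain ⟨⟨a₁, ha₁, hga₁⟩, ⟨b₁, hb₁, hgb₁⟩, hgs⟩ := hgl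
  obtain ⟨⟨a₂, ha₂, hha₂⟩, ⟨b₂, hb₂, hhb₂⟩, hhs⟩ := hhl
  have hgd := hg0.2.1.Icc_subset_effDom hg0.2.2 hga₁ hgb₁
  have hhd := hh0.2.1.Icc_subset_effDom hh0.2.2 hha₂ hhb₂
  have hle := hε.le
  have hub : ∀ θ, (a : EReal) * g θ + (b : EReal) * h θ ≤ max (g θ) (h θ) :=
    fun θ => coe_mul_add_le_max ha.le hb.le hab
  have hu0 := hg0.convex_comb hh0 ha hb
  have hul : ∀ θ ∈ Icc (etaL f k + ε) (etaR f k - ε),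
      (a : EReal) * g θ + (b : EReal) * h θ < fsharp f k ε θ :=
    fun θ hθ => (hub θ).trans_lt (max_lt (hgs θ hθ) (hhs θ hθ))
  refine ⟨hu0, mem_Vk_iff.2 fun x hx => ?_, hlll.2 ⟨?_, ?_, hul⟩⟩
  · have hsub : epiE (fsharp f k ε) ⊆ epiE (fun θ => (a : EReal) * g θ + (b : EReal) * h θ) := by
      refine epiE_anti fun θ => ?_
      by_cases hθ : θ ∈ Icc (etaL f k + ε) (etaR f k - ε)
      · exact (hul θ hθ).le
      · exact le_top.trans_eq (if_neg hθ).symm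
    have hne := hε.epiE_fsharp_nonempty hconv hnn
    have h1 := infDist_le_infDist_of_subset (x := x) hsub hne
    obtain ⟨p, hp, hxp⟩ := (isClosed_epiE hu0.1).exists_infDist_eq_dist (hne.mono hsub) x
    have hgx := (abs_lt.1 (mem_Vk_iff.1 hgV x hx)).1
    have hhx := (abs_lt.1 (mem_Vk_iff.1 hhV x hx)).1
    have hmin : min (g p.1) (h p.1) ≤ (p.2 : EReal) :=
      (min_le_coe_mul_add ha.le hb.le hab).trans hp
    have hlow : infDist x (epiE (fsharp f k ε)) < dist x p + 1 / (k : ℝ) := by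
      rcases min_le_iff.1 hmin with hp' | hp'
      · have : infDist x (epiE g) ≤ dist x p := infDist_le_dist_of_mem hp'
        linarith
      · have : infDist x (epiE h) ≤ dist x p := infDist_le_dist_of_mem hp'
        linarith
    rw [abs_lt]
    have hpos := (abs_nonneg _).trans_lt (mem_Vk_iff.1 hgV x hx)
    constructor <;> linarith
  · refine ⟨max a₁ a₂, max_lt ha₁ ha₂, (hub _).trans_lt (max_lt (hgd ⟨le_max_left _ _, ?_⟩)
      (hhd ⟨le_max_right _ _, ?_⟩))⟩ <;> exact max_le (by linarith) (by linarith)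
  · refine ⟨min b₁ b₂, lt_min hb₁ hb₂, (hub _).trans_lt (max_lt (hgd ⟨?_, min_le_left _ _⟩)
      (hhd ⟨?_, min_le_right _ _⟩))⟩ <;> exact le_min (by linarith) (by linarith)

/-- `{A_k(f)}` is a local convex base at `f`. -/
theorem local_convex_base
    (f : ℝ → EReal) (hlsc : LowerSemicontinuous f) (hconv : ERConvex f)
    (hnn : ∀ θ, 0 ≤ f θ) (h0 : f 0 = 1) (hD : effDom f ≠ {0})
    (k : ℕ) (hk : 1 ≤ k) (ε : ℝ) (hε : Adm f k ε) :
    f ∈ Ak f k ε ∧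
    (∀ g ∈ Ak f k ε, ∃ m : ℕ, 1 ≤ m ∧
      ∀ h ∈ Vk m g, IsAdm0 h → h ∈ Ak f k ε) ∧
    (∀ g ∈ Ak f k ε, ∀ h ∈ Ak f k ε, ∀ lam : ℝ, 0 ≤ lam → lam ≤ 1 →
      (fun θ => (lam : EReal) * g θ + ((1 - lam : ℝ) : EReal) * h θ) ∈ Ak f k ε) ∧
    (∀ ε' : ℝ, Adm f (2 * k) ε' → Ak f (2 * k) ε' ⊆ Vk k f) := by
  refine ⟨hε.mem_Ak hk hlsc hconv hnn h0,
    fun g hg => hε.exists_Vk_subset_Ak hk hconv hnn hg, fun g hg h hh lam hl0 hl1 => ?_,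
    fun ε' hε' => hε'.subset_Vk hk hlsc hconv hnn h0⟩
  rcases hl0.eq_or_lt with rfl | hl0
  · simpa using hh
  rcases hl1.eq_or_lt with rfl | hl1
  · simpa using hg
  exact hε.Ak_convex_comb hconv hnn hg hh hl0 (sub_pos.2 hl1) (add_sub_cancel _ _)

end
end
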